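/- arXiv:1101.3062 — 5 statements merged into one kernel-verified Lean document; each statement's English description precedes it below -/
import Mathlib

section
/- Let N > 0 be real, let λ, μ be natural numbers, and define f : ℝ³ → ℂ by f(x) = (x₁ - i x₂ - x₃)^λ · He_μ((√(8π)/N)(x₁ + x₃)) · exp(-(2π/N)(2x₁² + x₂² + 2x₃²)). Then f has the second spherical property for weight 2λ: for all φ ∈ ℝ and x ∈ ℝ³, f(ρ(κ(φ))⁻¹ x) = e^{-2iλφ} f(x). -/
open Matrix Complex Real

/-- The symmetric-square map `ρ([[a,b],[c,d]]) = [[a²,ab,b²],[2ac,ad+bc,2bd],[c²,cd,d²]]`. -/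
def rhoM (g : Matrix (Fin 2) (Fin 2) ℝ) : Matrix (Fin 3) (Fin 3) ℝ :=
  !![g 0 0 ^ 2, g 0 0 * g 0 1, g 0 1 ^ 2;
     2 * g 0 0 * g 1 0, g 0 0 * g 1 1 + g 0 1 * g 1 0, 2 * g 0 1 * g 1 1;
     g 1 0 ^ 2, g 1 0 * g 1 1, g 1 1 ^ 2]

/-- `κ(φ) = [[cos φ, sin φ], [-sin φ, cos φ]]`. -/
noncomputable def kappaMat (φ : ℝ) : Matrix (Fin 2) (Fin 2) ℝ :=
  !![Real.cos φ, Real.sin φ; -Real.sin φ, Real.cos φ]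

/-- `ρ(κ(φ))⁻¹ = ρ(κ(-φ))`, with the entries written out. -/
theorem rhoM_kappaMat_inv (φ : ℝ) :
    (rhoM (kappaMat φ))⁻¹ =
      !![Real.cos φ ^ 2, -(Real.cos φ * Real.sin φ), Real.sin φ ^ 2;
         2 * Real.cos φ * Real.sin φ, Real.cos φ ^ 2 - Real.sin φ ^ 2, -(2 * Real.cos φ * Real.sin φ);
         Real.sin φ ^ 2, Real.cos φ * Real.sin φ, Real.cos φ ^ 2] := by
  apply Matrix.inv_eq_right_inv
  have h := Real.sin_sq_add_cos_sq φ
  ext i j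
  fin_cases i <;> fin_cases j <;>
    simp [rhoM, kappaMat, Matrix.mul_apply, Fin.sum_univ_three] <;> grind

/-- `e^{-2iφ}` in terms of `cos φ` and `sin φ`. -/
theorem exp_neg_two_mul_I (φ : ℝ) :
    Complex.exp (-(2 * (φ : ℂ) * Complex.I)) =
      (Complex.cos φ ^ 2 - Complex.sin φ ^ 2)
        - 2 * Complex.cos φ * Complex.sin φ * Complex.I := by
  rw [show -(2 * (φ : ℂ) * Complex.I) = (-(2 * φ) : ℂ) * Complex.I by ring,
    Complex.exp_mul_I, Complex.cos_neg, Complex.sin_neg, Complex.cos_two_mul', Complex.sin_two_mul]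
  ring

/-- Let `N > 0`, `λ, μ ∈ ℕ`, and
`f(x) = (x₁ - ix₂ - x₃)^λ · He_μ((√(8π)/N)(x₁+x₃)) · exp(-(2π/N)(2x₁²+x₂²+2x₃²))`,
where `He_μ` is the probabilists' Hermite polynomial.  Then `f` has the second
spherical property for weight `2λ`: `f(ρ(κ(φ))⁻¹ x) = e^{-2iλφ} f(x)`. -/
theorem stmt7 (N : ℝ) (hN : 0 < N) (lam mu : ℕ) (f : (Fin 3 → ℝ) → ℂ)
    (hf : ∀ x : Fin 3 → ℝ,
      f x = ((x 0 : ℂ) - Complex.I * (x 1 : ℝ) - (x 2 : ℝ)) ^ lam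
        * ((Polynomial.aeval (Real.sqrt (8 * π) / N * (x 0 + x 2))
              (Polynomial.hermite mu) : ℝ) : ℂ)
        * Complex.exp (((-(2 * π / N) * (2 * (x 0) ^ 2 + (x 1) ^ 2 + 2 * (x 2) ^ 2) : ℝ) : ℂ))) :
    ∀ (φ : ℝ) (x : Fin 3 → ℝ),
      f ((rhoM (kappaMat φ))⁻¹ *ᵥ x)
        = Complex.exp (-(2 * (lam : ℂ) * (φ : ℂ) * Complex.I)) * f x := by
  intro φ x
  have h := Real.sin_sq_add_cos_sq φ
  obtain ⟨y, hy⟩ : ∃ y, y = (rhoM (kappaMat φ))⁻¹ *ᵥ x := ⟨_, rfl⟩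
  have y0 : y 0 = Real.cos φ ^ 2 * x 0 - Real.cos φ * Real.sin φ * x 1 + Real.sin φ ^ 2 * x 2 := by
    simp [hy, rhoM_kappaMat_inv, dotProduct, Fin.sum_univ_three]
    ring
  have y1 : y 1 = 2 * Real.cos φ * Real.sin φ * x 0 + (Real.cos φ ^ 2 - Real.sin φ ^ 2) * x 1
      - 2 * Real.cos φ * Real.sin φ * x 2 := by
    simp [hy, rhoM_kappaMat_inv, dotProduct, Fin.sum_univ_three]
    ring
  have y2 : y 2 = Real.sin φ ^ 2 * x 0 + Real.cos φ * Real.sin φ * x 1 + Real.cos φ ^ 2 * x 2 := by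
    simp [hy, rhoM_kappaMat_inv, dotProduct, Fin.sum_univ_three]
  have trace_eq : y 0 + y 2 = x 0 + x 2 := by
    rw [y0, y2]
    linear_combination (x 0 + x 2) * h
  have diff_eq : y 0 - y 2 =
      (Real.cos φ ^ 2 - Real.sin φ ^ 2) * (x 0 - x 2) - 2 * Real.cos φ * Real.sin φ * x 1 := by
    rw [y0, y2]
    ring
  have quad_eq : 2 * y 0 ^ 2 + y 1 ^ 2 + 2 * y 2 ^ 2 = 2 * x 0 ^ 2 + x 1 ^ 2 + 2 * x 2 ^ 2 := by
    have rotation : (y 0 - y 2) ^ 2 + y 1 ^ 2 = (x 0 - x 2) ^ 2 + x 1 ^ 2 := by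
      rw [diff_eq, y1]
      linear_combination
        ((x 0 - x 2) ^ 2 + x 1 ^ 2) * (Real.sin φ ^ 2 + Real.cos φ ^ 2 + 1) * h
    linear_combination rotation + (y 0 + y 2 + x 0 + x 2) * trace_eq
  have linear_eq : (y 0 : ℂ) - Complex.I * (y 1 : ℝ) - (y 2 : ℝ) =
      Complex.exp (-(2 * (φ : ℂ) * Complex.I)) *
        ((x 0 : ℂ) - Complex.I * (x 1 : ℝ) - (x 2 : ℝ)) := by
    rw [exp_neg_two_mul_I, y0, y1, y2]
    push_cast
    linear_combination
      -2 * Complex.cos φ * Complex.sin φ * (x 1 : ℂ) * Complex.I_sq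
  have exp_eq : Complex.exp (-(2 * (lam : ℂ) * (φ : ℂ) * Complex.I)) =
      Complex.exp (-(2 * (φ : ℂ) * Complex.I)) ^ lam := by
    rw [← Complex.exp_nat_mul]
    congr 1
    ring
  rw [← hy, hf, hf, linear_eq, trace_eq, quad_eq, exp_eq, mul_pow]
  ring
end

section
/- For every natural number ν and every s ∈ ℂ with Re s > ν: ∫₀^∞ y^{s-1} He_ν(y) e^{-y²/2} dy = (∏_{j=1}^{ν} (s - j)) · 2^{(s-ν)/2 - 1} · Γ((s-ν)/2), where Γ is the complex Gamma function. -/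
open Complex Real

open MeasureTheory Set

/-- `y ^ (s - 1) p(y) e ^ (-y² / 2)` is integrable on `(0, ∞)` for every polynomial `p`
as soon as `0 < Re s`. -/
lemma integrableOn_cpow_mul_aeval_mul_gaussian (p : Polynomial ℤ) {s : ℂ} (hs : 0 < s.re) :
    IntegrableOn (fun y : ℝ ↦ (y : ℂ) ^ (s - 1) * Polynomial.aeval (y : ℂ) p *
      Complex.exp (-(y : ℂ) ^ 2 / 2)) (Ioi 0) := by
  induction p using Polynomial.induction_on' with
  | add p q hp hq =>
    refine (hp.add hq).congr (.of_forall fun y ↦ ?_)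
    simp only [Pi.add_apply, map_add]
    ring
  | monomial n a =>
    have hint : IntegrableOn (fun y : ℝ ↦ y ^ (s.re - 1 + n) * rexp (-(1 / 2) * y ^ 2)) (Ioi 0) :=
      integrableOn_rpow_mul_exp_neg_mul_sq (by norm_num)
        (by have : (0 : ℝ) ≤ n := n.cast_nonneg
            linarith)
    refine (hint.const_mul ‖(a : ℂ)‖).mono' ?_ ?_
    · refine ContinuousOn.aestronglyMeasurable (fun y hy ↦ ?_) measurableSet_Ioi
      have h1 : ContinuousAt (fun y : ℝ ↦ (y : ℂ) ^ (s - 1)) y :=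
        continuousAt_ofReal_cpow_const _ _ (Or.inr (ne_of_gt hy))
      have h2 : ContinuousAt (fun y : ℝ ↦ Polynomial.aeval (y : ℂ) (Polynomial.monomial n a)) y :=
        ((Polynomial.continuous_aeval _).comp continuous_ofReal).continuousAt
      have h3 : ContinuousAt (fun y : ℝ ↦ Complex.exp (-(y : ℂ) ^ 2 / 2)) y := by fun_prop
      exact ((h1.mul h2).mul h3).continuousWithinAt
    · refine (ae_restrict_iff' measurableSet_Ioi).2 (.of_forall fun y (hy : 0 < y) ↦ le_of_eq ?_)
      have hexp : Complex.exp (-(y : ℂ) ^ 2 / 2) = (rexp (-(1 / 2) * y ^ 2) : ℝ) := by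
        push_cast
        ring_nf
      rw [hexp, Polynomial.aeval_monomial, norm_mul, norm_mul, norm_mul, norm_pow,
        norm_cpow_eq_rpow_re_of_pos hy, norm_real, norm_real, Real.norm_of_nonneg hy.le,
        Real.norm_of_nonneg (Real.exp_pos _).le, Real.rpow_add hy, Real.rpow_natCast]
      simp
      ring

/-- Integration by parts lowers the Hermite index and the exponent simultaneously. -/
lemma integral_cpow_mul_hermite_succ_mul_gaussian (n : ℕ) {s : ℂ} (hs : 1 < s.re) :
    ∫ y in Ioi (0 : ℝ), (y : ℂ) ^ (s - 1) * Polynomial.aeval (y : ℂ) (Polynomial.hermite (n + 1)) *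
        Complex.exp (-(y : ℂ) ^ 2 / 2) =
      (s - 1) * ∫ y in Ioi (0 : ℝ), (y : ℂ) ^ (s - 1 - 1) *
        Polynomial.aeval (y : ℂ) (Polynomial.hermite n) * Complex.exp (-(y : ℂ) ^ 2 / 2) := by
  have hs' : 0 < (s - 1).re := by simpa using hs
  have hne : s - 1 ≠ 0 := fun h ↦ by simp [h] at hs'
  have hint := integrableOn_cpow_mul_aeval_mul_gaussian (Polynomial.hermite n)
    (zero_lt_one.trans hs)
  have hint₁ := (integrableOn_cpow_mul_aeval_mul_gaussian (Polynomial.hermite n) hs').const_mul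
    (s - 1)
  have hint₂ := integrableOn_cpow_mul_aeval_mul_gaussian (Polynomial.hermite (n + 1))
    (zero_lt_one.trans hs)
  have hexp (y : ℝ) : HasDerivAt (fun y : ℝ ↦ Complex.exp (-(y : ℂ) ^ 2 / 2))
      (Complex.exp (-(y : ℂ) ^ 2 / 2) * -y) y := by
    have hsq : HasDerivAt (fun z : ℂ ↦ -z ^ 2 / 2) (-y : ℂ) (y : ℂ) :=
      ((hasDerivAt_pow 2 (y : ℂ)).fun_neg.div_const 2).congr_deriv (by push_cast; ring)
    exact hsq.cexp.comp_ofReal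
  have hderiv : ∀ y ∈ Ioi (0 : ℝ), HasDerivAt (fun y : ℝ ↦ (y : ℂ) ^ (s - 1) *
        Polynomial.aeval (y : ℂ) (Polynomial.hermite n) * Complex.exp (-(y : ℂ) ^ 2 / 2))
      ((s - 1) * ((y : ℂ) ^ (s - 1 - 1) * Polynomial.aeval (y : ℂ) (Polynomial.hermite n) *
          Complex.exp (-(y : ℂ) ^ 2 / 2)) -
        (y : ℂ) ^ (s - 1) * Polynomial.aeval (y : ℂ) (Polynomial.hermite (n + 1)) *
          Complex.exp (-(y : ℂ) ^ 2 / 2)) y := by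
    intro y hy
    refine (((hasDerivAt_ofReal_cpow_const (ne_of_gt hy) hne).mul
      ((Polynomial.hermite n).hasDerivAt_aeval (y : ℂ)).comp_ofReal).mul (hexp y)).congr_deriv ?_
    simp only [Polynomial.hermite_succ, map_sub, map_mul, Polynomial.aeval_X, Pi.mul_apply]
    ring
  have hcont : ContinuousWithinAt (fun y : ℝ ↦ (y : ℂ) ^ (s - 1) *
      Polynomial.aeval (y : ℂ) (Polynomial.hermite n) * Complex.exp (-(y : ℂ) ^ 2 / 2))
      (Ici 0) 0 := by
    refine (((continuousAt_ofReal_cpow_const _ _ (Or.inl hs')).mul ?_).mul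
      (hexp 0).continuousAt).continuousWithinAt
    exact ((Polynomial.continuous_aeval _).comp continuous_ofReal).continuousAt
  have h := integral_Ioi_of_hasDerivAt_of_tendsto hcont hderiv (hint₁.sub hint₂)
    (tendsto_zero_of_hasDerivAt_of_integrableOn_Ioi hderiv (hint₁.sub hint₂) hint)
  rw [integral_sub hint₁ hint₂, integral_const_mul] at h
  simp only [ofReal_zero, zero_cpow hne, zero_mul, sub_zero] at h
  exact (sub_eq_zero.1 h).symm

/-- The Mellin transform of the Gaussian `e ^ (-y² / 2)`. -/
lemma integral_cpow_mul_gaussian {s : ℂ} (hs : 0 < s.re) :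
    ∫ y in Ioi (0 : ℝ), (y : ℂ) ^ (s - 1) * Complex.exp (-(y : ℂ) ^ 2 / 2) =
      (2 : ℂ) ^ (s / 2 - 1) * Complex.Gamma (s / 2) := by
  have hs2 : 0 < (s / 2).re := by simpa using hs
  have h := mellin_comp_rpow (fun t : ℝ ↦ Complex.exp (-((1 / 2 : ℝ) * t))) s 2
  have hG := Complex.integral_cpow_mul_exp_neg_mul_Ioi hs2 (r := 1 / 2) (by norm_num)
  simp only [mellin, smul_eq_mul, ofReal_ofNat] at h
  rw [hG] at h
  convert h using 1
  · refine setIntegral_congr_fun measurableSet_Ioi fun y _ ↦ ?_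
    simp only [Real.rpow_ofNat]
    push_cast
    ring_nf
  · rw [cpow_sub _ _ two_ne_zero, cpow_one]
    norm_num
    ring

/-- For `ν ∈ ℕ` and `s ∈ ℂ` with `Re s > ν`:
`∫₀^∞ y^{s-1} He_ν(y) e^{-y²/2} dy = (∏_{j=1}^{ν} (s-j)) · 2^{(s-ν)/2-1} · Γ((s-ν)/2)`,
where `He_ν` is the probabilists' Hermite polynomial. -/
theorem stmt10 (ν : ℕ) (s : ℂ) (hs : (ν : ℝ) < s.re) :
    ∫ y in Set.Ioi (0 : ℝ),
        (y : ℂ) ^ (s - 1) * Polynomial.aeval (y : ℂ) (Polynomial.hermite ν) *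
          Complex.exp (-(y : ℂ) ^ 2 / 2)
      = (∏ j ∈ Finset.Icc 1 ν, (s - (j : ℂ))) * (2 : ℂ) ^ ((s - (ν : ℂ)) / 2 - 1) *
          Complex.Gamma ((s - (ν : ℂ)) / 2) := by
  induction ν generalizing s with
  | zero => simpa using integral_cpow_mul_gaussian (by simpa using hs)
  | succ n ih =>
    push_cast at hs
    have hn : (0 : ℝ) ≤ n := n.cast_nonneg
    have hprod : ∏ j ∈ Finset.Icc 1 (n + 1), (s - (j : ℂ)) =
        (s - 1) * ∏ j ∈ Finset.Icc 1 n, (s - 1 - (j : ℂ)) := by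
      simp only [← Finset.Ico_add_one_right_eq_Icc, Finset.prod_Ico_eq_prod_range,
        Nat.add_sub_cancel]
      rw [Finset.prod_range_succ', mul_comm]
      congr 1
      · simp
      · refine Finset.prod_congr rfl fun j _ ↦ ?_
        push_cast
        ring
    rw [integral_cpow_mul_hermite_succ_mul_gaussian n (by linarith),
      ih (s - 1) (by simpa using by linarith), hprod,
      show s - ((n + 1 : ℕ) : ℂ) = s - 1 - n by push_cast; ring]
    ring
end

section
/- Let q be a positive integer, let χ be a Dirichlet character modulo q with values in ℂ, let a > 0 be real, let λ, ν be integers, and let s ∈ ℂ with Re s > ν - 1 and Re s > λ. Then ∫₀^∞ η^{s-ν} (∑_{m=1}^∞ χ(m) m^{λ-ν} e^{-a m² η²}) dη = (1/2) · a^{(ν-s-1)/2} · Γ((s+1-ν)/2) · L(s+1-λ, χ), where L(s+1-λ, χ) = ∑_{m=1}^∞ χ(m) m^{-(s+1-λ)} is the Dirichlet L-series of χ (absolutely convergent since Re(s+1-λ) > 1). -/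
open Complex Real

lemma rexp_neg_le_div_rpow {σ x : ℝ} (hσ : 0 < σ) (hx : 0 < x) :
    rexp (-x) ≤ σ ^ σ / x ^ σ := by
  have h : (x / σ) ^ σ ≤ rexp x := by
    calc (x / σ) ^ σ ≤ rexp (x / σ) ^ σ := by
          gcongr
          linarith [Real.add_one_le_exp (x / σ)]
      _ = rexp x := by rw [← Real.exp_mul, div_mul_cancel₀ _ hσ.ne']
  rw [Real.div_rpow hx.le hσ.le] at h
  rw [Real.exp_neg, ← inv_div]
  exact inv_anti₀ (by positivity) h

/-- If a Dirichlet series with frequencies `p i` converges absolutely at some `σ > 0`, then the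
corresponding series of exponentials converges at every `t > 0`. -/
lemma summable_mul_rexp_of_summable_div_rpow {ι : Type*} {c : ι → ℂ} {p : ι → ℝ} {σ t : ℝ}
    (hp : ∀ i, 0 < p i) (hσ : 0 < σ) (ht : 0 < t)
    (h : Summable fun i ↦ ‖c i‖ / p i ^ σ) :
    Summable fun i ↦ c i * rexp (-p i * t) := by
  refine (h.mul_right (σ ^ σ / t ^ σ)).of_norm_bounded fun i ↦ ?_
  have hexp := rexp_neg_le_div_rpow hσ (mul_pos (hp i) ht)
  rw [Real.mul_rpow (hp i).le ht.le] at hexp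
  rw [norm_mul, norm_real, Real.norm_eq_abs, Real.abs_exp, neg_mul]
  calc ‖c i‖ * rexp (-(p i * t)) ≤ ‖c i‖ * (σ ^ σ / (p i ^ σ * t ^ σ)) := by gcongr
    _ = ‖c i‖ / p i ^ σ * (σ ^ σ / t ^ σ) := by
      rw [div_mul_div_comm, mul_div_assoc]

/-- The Mellin transform of a series of Gaussians is a Dirichlet series. -/
lemma hasSum_mellin_tsum_mul_rexp_sq {ι : Type*} [Countable ι] {c : ι → ℂ} {p : ι → ℝ} {w : ℂ}
    (hp : ∀ i, 0 < p i) (hw : 0 < w.re)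
    (h : Summable fun i ↦ ‖c i‖ / p i ^ (w.re / 2)) :
    HasSum (fun i ↦ 1 / 2 * (Complex.Gamma (w / 2) * c i / (p i : ℂ) ^ (w / 2)))
      (mellin (fun t ↦ ∑' i, c i * rexp (-p i * t ^ 2)) w) := by
  have hre : (w / 2).re = w.re / 2 := by simp
  have hsum := hasSum_mellin (F := fun t ↦ ∑' i, c i * rexp (-p i * t)) (s := w / 2)
    (fun i ↦ Or.inr (hp i)) (by rw [hre]; positivity)
    (fun t ht ↦ (summable_mul_rexp_of_summable_div_rpow hp (half_pos hw) ht h).hasSum)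
    (by rwa [hre])
  have hcomp := mellin_comp_rpow (fun t ↦ ∑' i, c i * rexp (-p i * t)) w 2
  simp only [Real.rpow_two, abs_two, ofReal_ofNat] at hcomp
  rw [hcomp, Complex.real_smul]
  simpa using hsum.mul_left (1 / 2 : ℂ)

lemma zpow_div_mul_sq_cpow {a x : ℝ} (ha : 0 < a) (hx : 0 < x) (k : ℤ) (w : ℂ) :
    (x : ℂ) ^ k / ((a * x ^ 2 : ℝ) : ℂ) ^ (w / 2) = (a : ℂ) ^ (-w / 2) / (x : ℂ) ^ (w - k) := by
  have hx0 : (x : ℂ) ≠ 0 := ofReal_ne_zero.mpr hx.ne'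
  have hsq : (((x ^ 2 : ℝ)) : ℂ) ^ (w / 2) = (x : ℂ) ^ w := by
    rw [← Real.rpow_two, ← cpow_mul_ofReal_nonneg hx.le]
    congr 1
    push_cast
    ring
  rw [ofReal_mul, mul_cpow_ofReal_nonneg ha.le (by positivity), hsq, cpow_sub _ _ hx0,
    cpow_intCast, neg_div, cpow_neg, div_div_eq_mul_div, mul_comm ((a : ℂ) ^ (w / 2)),
    ← div_div, div_eq_mul_inv (_ / _)]
  ring

/-- Let `χ` be a Dirichlet character mod `q`, `a > 0`, `λ, ν ∈ ℤ`, and `s ∈ ℂ` with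
`Re s > ν - 1` and `Re s > λ`.  Then
`∫₀^∞ η^{s-ν} (∑_{m≥1} χ(m) m^{λ-ν} e^{-am²η²}) dη
  = (1/2) a^{(ν-s-1)/2} Γ((s+1-ν)/2) L(s+1-λ, χ)`. -/
theorem stmt11 (q : ℕ) (hq : 0 < q) (χ : DirichletCharacter ℂ q)
    (a : ℝ) (ha : 0 < a) (lam ν : ℤ) (s : ℂ)
    (hs1 : (ν : ℝ) - 1 < s.re) (hs2 : (lam : ℝ) < s.re) :
    ∫ η in Set.Ioi (0 : ℝ),
        (η : ℂ) ^ (s - (ν : ℂ)) *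
          ∑' m : ℕ, χ ((m + 1 : ℕ) : ZMod q) * ((m + 1 : ℕ) : ℂ) ^ (lam - ν) *
            Complex.exp (-(a : ℂ) * ((m + 1 : ℕ) : ℂ) ^ 2 * (η : ℂ) ^ 2)
      = (1 / 2) * (a : ℂ) ^ (((ν : ℂ) - s - 1) / 2) *
          Complex.Gamma ((s + 1 - (ν : ℂ)) / 2) *
          LSeries (fun n => χ ((n : ℕ) : ZMod q)) (s + 1 - (lam : ℂ)) := by
  set w : ℂ := s + 1 - ν with hw_def
  set c : ℕ → ℂ := fun m ↦ χ ((m + 1 : ℕ) : ZMod q) * ((m + 1 : ℕ) : ℂ) ^ (lam - ν) with hc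
  set p : ℕ → ℝ := fun m ↦ a * ((m + 1 : ℕ) : ℝ) ^ 2 with hp_def
  set f : ℕ → ℂ := fun n ↦ χ (n : ZMod q)
  have hp (m : ℕ) : 0 < p m := by positivity
  have hw : 0 < w.re := by
    simp only [hw_def, sub_re, add_re, one_re, intCast_re]
    linarith
  have hterm (m : ℕ) : c m / (p m : ℂ) ^ (w / 2) =
      (a : ℂ) ^ (-w / 2) * LSeries.term f (s + 1 - lam) (m + 1) := by
    have h := zpow_div_mul_sq_cpow ha (x := ((m + 1 : ℕ) : ℝ)) (by positivity) (lam - ν) w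
    rw [ofReal_natCast] at h
    have hexp : w - ((lam - ν : ℤ) : ℂ) = s + 1 - lam := by
      rw [hw_def]; push_cast; ring
    rw [LSeries.term_of_ne_zero m.succ_ne_zero, hc, mul_div_assoc, h, hexp]
    ring
  have hL : LSeriesSummable f (s + 1 - lam) := by
    refine DirichletCharacter.LSeriesSummable_of_one_lt_re χ ?_
    simp only [sub_re, add_re, one_re, intCast_re]
    linarith
  have hsum : Summable fun m ↦ ‖c m‖ / p m ^ (w.re / 2) := by
    have h := (((summable_nat_add_iff 1).mpr hL).mul_left ((a : ℂ) ^ (-w / 2))).norm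
    refine h.congr fun m ↦ ?_
    rw [← hterm, norm_div, norm_cpow_eq_rpow_re_of_pos (hp m)]
    simp
  have hmellin := (hasSum_mellin_tsum_mul_rexp_sq hp hw hsum).tsum_eq
  have hint : ∫ η in Set.Ioi (0 : ℝ), (η : ℂ) ^ (s - (ν : ℂ)) *
      ∑' m : ℕ, c m * Complex.exp (-(a : ℂ) * ((m + 1 : ℕ) : ℂ) ^ 2 * (η : ℂ) ^ 2) =
      mellin (fun t ↦ ∑' m, c m * rexp (-p m * t ^ 2)) w := by
    rw [mellin, show w - 1 = s - ν by rw [hw_def]; ring]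
    simp [hp_def]
  have hLtsum : LSeries f (s + 1 - lam) = ∑' m, LSeries.term f (s + 1 - lam) (m + 1) := by
    rw [LSeries, hL.tsum_eq_zero_add, LSeries.term_zero, zero_add]
  rw [hint, ← hmellin, hLtsum, ← tsum_mul_left]
  refine tsum_congr fun m ↦ ?_
  rw [mul_div_assoc, hterm, show ((ν : ℂ) - s - 1) / 2 = -w / 2 by rw [hw_def]; ring]
  ring
end

section
/- For every natural number n, the function h_n : ℝ → ℂ defined by h_n(x) = He_n(2√π · x) · e^{-π x²} is an eigenfunction of the Fourier transform with eigenvalue (-i)^n: for all ξ ∈ ℝ, ∫_{ℝ} h_n(x) e^{-2πi x ξ} dx = (-i)^n · h_n(ξ). -/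
open Complex Real

open scoped FourierTransform Polynomial

open MeasureTheory

/-- The product of a complex polynomial with the Gaussian `e^{-πx²}`. -/
noncomputable def polyGaussian (p : ℂ[X]) (x : ℝ) : ℂ :=
  p.eval (x : ℂ) * cexp (-π * (x : ℂ) ^ 2)

lemma integrable_polyGaussian (p : ℂ[X]) : Integrable (polyGaussian p) := by
  induction p using Polynomial.induction_on' with
  | add p q hp hq =>
    have : polyGaussian (p + q) = polyGaussian p + polyGaussian q := by
      ext x
      simp [polyGaussian, add_mul]
    rw [this]
    exact hp.add hq
  | monomial n a =>
    have hn : (-1 : ℝ) < n := by linarith [n.cast_nonneg (α := ℝ)]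
    have := ((integrable_rpow_mul_exp_neg_mul_sq pi_pos hn).ofReal (𝕜 := ℂ)).const_mul a
    refine this.congr (.of_forall fun x => ?_)
    simp [polyGaussian, Polynomial.eval_monomial, mul_assoc]

lemma hasDerivAt_polyGaussian (p : ℂ[X]) (x : ℝ) :
    HasDerivAt (polyGaussian p)
      (polyGaussian (p.derivative - Polynomial.C (2 * π : ℂ) * Polynomial.X * p) x) x := by
  have hg : HasDerivAt (fun z : ℂ => cexp (-π * z ^ 2))
      (cexp (-π * (x : ℂ) ^ 2) * (-π * (2 * x))) x := by
    simpa using ((hasDerivAt_pow 2 (x : ℂ)).const_mul (-π : ℂ)).cexp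
  refine ((p.hasDerivAt (x : ℂ)).mul hg).comp_ofReal.congr_deriv ?_
  simp only [polyGaussian, Polynomial.eval_sub, Polynomial.eval_mul, Polynomial.eval_C,
    Polynomial.eval_X]
  ring

/-- The polynomial `He_n(2√π x)`, with complex coefficients. -/
noncomputable def scaledHermite (n : ℕ) : ℂ[X] :=
  ((Polynomial.hermite n).map (Int.castRingHom ℂ)).comp
    (Polynomial.C (2 * (√π : ℂ)) * Polynomial.X)

lemma sqrt_pi_sq : (√π : ℂ) ^ 2 = π := by
  exact_mod_cast Real.sq_sqrt pi_pos.le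

lemma sqrt_pi_ne_zero : (√π : ℂ) ≠ 0 := by
  exact_mod_cast (Real.sqrt_pos.mpr pi_pos).ne'

/-- The creation-operator recurrence `h_{n+1} = √π x h_n - h_n' / (2√π)`. -/
lemma polyGaussian_scaledHermite_succ (n : ℕ) (x : ℝ) :
    polyGaussian (scaledHermite (n + 1)) x =
      √π * (x * polyGaussian (scaledHermite n) x) -
        (2 * (√π : ℂ))⁻¹ * deriv (polyGaussian (scaledHermite n)) x := by
  rw [(hasDerivAt_polyGaussian _ x).deriv]
  have h0 := sqrt_pi_ne_zero
  simp only [polyGaussian, scaledHermite, Polynomial.hermite_succ, Polynomial.map_sub,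
    Polynomial.map_mul, Polynomial.map_X, Polynomial.derivative_comp, Polynomial.eval_sub,
    Polynomial.sub_comp, Polynomial.mul_comp, Polynomial.X_comp, Polynomial.eval_mul,
    Polynomial.eval_C, Polynomial.eval_X, Polynomial.derivative_map, Polynomial.derivative_mul,
    Polynomial.derivative_C, Polynomial.derivative_X, zero_mul, zero_add, mul_one]
  generalize cexp _ = g
  rw [← sqrt_pi_sq]
  field_simp
  ring

lemma fourier_polyGaussian_scaledHermite (n : ℕ) (ξ : ℝ) :
    𝓕 (polyGaussian (scaledHermite n)) ξ = (-I) ^ n * polyGaussian (scaledHermite n) ξ := by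
  induction n generalizing ξ with
  | zero =>
    have := congrFun (fourier_gaussian_pi (b := 1) (by simp)) ξ
    have hg : polyGaussian (scaledHermite 0) = fun x : ℝ => cexp (-π * 1 * (x : ℂ) ^ 2) := by
      ext x
      simp [polyGaussian, scaledHermite]
    rw [hg, this]
    simp
  | succ n ih =>
    set f := polyGaussian (scaledHermite n) with hf
    have hint : Integrable f := integrable_polyGaussian _
    have hdiff : Differentiable ℝ f := fun x => (hasDerivAt_polyGaussian _ x).differentiableAt
    have hxint : Integrable fun x : ℝ => (x : ℂ) * f x := by
      refine (integrable_polyGaussian (Polynomial.X * scaledHermite n)).congr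
        (.of_forall fun x => ?_)
      simp [f, polyGaussian, mul_assoc]
    have hderiv : Integrable (deriv f) := by
      rw [funext fun x => (hasDerivAt_polyGaussian (scaledHermite n) x).deriv]
      exact integrable_polyGaussian _
    have hFderiv : 𝓕 (deriv f) ξ = 2 * π * I * ξ * ((-I) ^ n * f ξ) := by
      simp only [fourier_deriv hint hdiff hderiv, smul_eq_mul, ih]
    have hFmul : (-2 * π * I) * 𝓕 (fun x : ℝ => (x : ℂ) * f x) ξ = (-I) ^ n * deriv f ξ := by
      have h1 := (hasDerivAt_fourier hint (by simpa using hxint) ξ).deriv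
      rw [funext ih, deriv_const_mul _ (hdiff ξ)] at h1
      rw [h1, Real.fourier_eq, Real.fourier_eq, ← integral_const_mul]
      congr 1 with x
      simp only [Circle.smul_def, smul_eq_mul]
      ring
    have hsucc : 𝓕 (polyGaussian (scaledHermite (n + 1))) ξ =
        √π * 𝓕 (fun x : ℝ => (x : ℂ) * f x) ξ - (2 * (√π : ℂ))⁻¹ * 𝓕 (deriv f) ξ := by
      rw [funext (polyGaussian_scaledHermite_succ n)]
      simp only [Real.fourier_eq, ← integral_const_mul]
      rw [← integral_sub]
      · congr 1 with x
        simp only [Circle.smul_def, smul_eq_mul, ← hf]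
        ring
      · exact ((Real.fourierIntegral_convergent_iff ξ).2 hxint).const_mul _
      · exact ((Real.fourierIntegral_convergent_iff ξ).2 hderiv).const_mul _
    rw [hsucc, polyGaussian_scaledHermite_succ, hFderiv, ← hf]
    have h0 := sqrt_pi_ne_zero
    have hX : 𝓕 (fun x : ℝ => (x : ℂ) * f x) ξ =
        I * (2 * (√π : ℂ) ^ 2)⁻¹ * ((-I) ^ n * deriv f ξ) := by
      rw [← hFmul, ← sqrt_pi_sq]
      field_simp
      linear_combination 𝓕 (fun x : ℝ => (x : ℂ) * f x) ξ * I_sq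
    rw [hX, ← sqrt_pi_sq, pow_succ]
    field_simp
    ring

/-- For `n ∈ ℕ`, the function `h_n(x) = He_n(2√π x) e^{-πx²}` (with `He_n` the
probabilists' Hermite polynomial) is an eigenfunction of the Fourier transform with
eigenvalue `(-i)^n`: `∫ h_n(x) e^{-2πixξ} dx = (-i)^n h_n(ξ)`. -/
theorem stmt12 (n : ℕ) (h : ℝ → ℂ)
    (hh : ∀ x : ℝ,
      h x = ((Polynomial.aeval (2 * Real.sqrt π * x) (Polynomial.hermite n) : ℝ) : ℂ) *
        Complex.exp (((-π * x ^ 2 : ℝ) : ℂ))) :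
    ∀ ξ : ℝ,
      (∫ x : ℝ, h x * Complex.exp (-(2 * (π : ℂ) * (x : ℂ) * (ξ : ℂ)) * Complex.I))
        = (-Complex.I) ^ n * h ξ := by
  intro ξ
  have hfun : h = polyGaussian (scaledHermite n) := by
    ext x
    rw [hh, polyGaussian, scaledHermite, Polynomial.eval_comp, Polynomial.eval_map,
      ← Complex.coe_algebraMap, ← Polynomial.aeval_algebraMap_apply, Polynomial.aeval_def]
    simp
  rw [hfun, ← fourier_polyGaussian_scaledHermite, Real.fourier_real_eq_integral_exp_smul]
  congr 1 with x
  rw [smul_eq_mul, mul_comm]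
  push_cast
  ring_nf
end

section
/- Let t > 1 and let h : ℍ → ℂ be smooth (infinitely differentiable as a function of (u,v)) and satisfy h(γz) = (conj(cz+d))² · h(z) for every γ = [[a,b],[c,d]] ∈ SL₂(ℤ) and every z ∈ ℍ (equivalently, the 1-form h(z) dz̄ is SL₂(ℤ)-invariant). Then ∫_{F_t} (∂h/∂v + i ∂h/∂u)(u+iv) du dv = ∫_{-1/2}^{1/2} h(u + it) du. -/
open Complex MeasureTheory

/-- The truncated fundamental domain
`F_t = {z = u+iv ∈ ℍ : u² + v² ≥ 1, |u| ≤ 1/2, v ≤ t}` of `SL₂(ℤ)`. -/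
def Ftrunc (t : ℝ) : Set ℂ :=
  {z : ℂ | 0 < z.im ∧ 1 ≤ z.re ^ 2 + z.im ^ 2 ∧ |z.re| ≤ 1 / 2 ∧ z.im ≤ t}

/-- The height of the unit circle above the point `u` of the real axis. -/
noncomputable def arcHeight (u : ℝ) : ℝ := √(1 - u ^ 2)

lemma arcHeight_neg (u : ℝ) : arcHeight (-u) = arcHeight u := by
  simp [arcHeight]

lemma one_sub_sq_pos {u : ℝ} (hu : |u| ≤ 1 / 2) : 0 < 1 - u ^ 2 := by
  have := sq_le_sq' (abs_le.1 hu).1 (abs_le.1 hu).2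
  linarith

lemma arcHeight_pos {u : ℝ} (hu : |u| ≤ 1 / 2) : 0 < arcHeight u :=
  Real.sqrt_pos.2 (one_sub_sq_pos hu)

lemma arcHeight_sq {u : ℝ} (hu : |u| ≤ 1 / 2) : arcHeight u ^ 2 = 1 - u ^ 2 :=
  Real.sq_sqrt (one_sub_sq_pos hu).le

lemma arcHeight_le_one (u : ℝ) : arcHeight u ≤ 1 :=
  Real.sqrt_le_one.2 (by nlinarith [sq_nonneg u])

lemma continuous_arcHeight : Continuous arcHeight := by
  unfold arcHeight
  fun_prop

lemma hasDerivAt_arcHeight {u : ℝ} (hu : |u| ≤ 1 / 2) :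
    HasDerivAt arcHeight (-u / arcHeight u) u := by
  have h := (((hasDerivAt_id u).pow 2).const_sub 1).sqrt (one_sub_sq_pos hu).ne'
  refine h.congr_deriv ?_
  have := (arcHeight_pos hu).ne'
  simp only [arcHeight, id] at this ⊢
  simp
  field_simp

lemma mem_Ftrunc_iff {t u v : ℝ} :
    (⟨u, v⟩ : ℂ) ∈ Ftrunc t ↔ |u| ≤ 1 / 2 ∧ v ∈ Set.Icc (arcHeight u) t := by
  simp only [Ftrunc, Set.mem_ofPred_eq, Set.mem_Icc]
  constructor
  · rintro ⟨hv, h1, hu, hvt⟩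
    exact ⟨hu, Real.sqrt_le_iff.2 ⟨hv.le, by linarith⟩, hvt⟩
  · rintro ⟨hu, hv, hvt⟩
    have h0 := arcHeight_pos hu
    have h1 := arcHeight_sq hu
    exact ⟨h0.trans_le hv, by nlinarith, hu, hvt⟩

lemma isCompact_Ftrunc (t : ℝ) : IsCompact (Ftrunc t) := by
  have hK : IsCompact (Set.Icc (-(1 / 2) : ℝ) (1 / 2) ×ℂ Set.Icc (0 : ℝ) t) :=
    isCompact_Icc.reProdIm isCompact_Icc
  have hEq : Ftrunc t = (Set.Icc (-(1 / 2) : ℝ) (1 / 2) ×ℂ Set.Icc (0 : ℝ) t) ∩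
      {z : ℂ | arcHeight z.re ≤ z.im} := by
    ext ⟨u, v⟩
    rw [mem_Ftrunc_iff]
    simp only [Set.mem_inter_iff, mem_reProdIm, Set.mem_Icc, Set.mem_ofPred_eq, ← abs_le]
    constructor
    · rintro ⟨hu, hv, hvt⟩
      exact ⟨⟨hu, (arcHeight_pos hu).le.trans hv, hvt⟩, hv⟩
    · rintro ⟨⟨hu, -, hvt⟩, hv⟩
      exact ⟨hu, hv, hvt⟩
  rw [hEq]
  exact hK.inter_right
    (isClosed_le (continuous_arcHeight.comp continuous_re) continuous_im)

lemma Ftrunc_subset (t : ℝ) : Ftrunc t ⊆ {z : ℂ | 0 < z.im} := fun _ hz => hz.1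

/-- Fubini on the truncated fundamental domain. -/
lemma setIntegral_Ftrunc {t : ℝ} (ht : 1 ≤ t) {g : ℂ → ℂ} (hg : ContinuousOn g (Ftrunc t)) :
    ∫ z in Ftrunc t, g z =
      ∫ u in (-(1 / 2) : ℝ)..(1 / 2), ∫ v in arcHeight u..t, g (u + v * I) := by
  have hmeas : MeasurableSet (Ftrunc t) := (isCompact_Ftrunc t).measurableSet
  have hint : Integrable ((Ftrunc t).indicator g) :=
    (integrable_indicator_iff hmeas).2 (hg.integrableOn_compact (isCompact_Ftrunc t))
  have hmp := volume_preserving_equiv_real_prod.symm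
  have hint' : Integrable (fun p => (Ftrunc t).indicator g (measurableEquivRealProd.symm p))
      (volume.prod volume) :=
    (hmp.integrable_comp_emb (MeasurableEquiv.measurableEmbedding _)).2 hint
  rw [← integral_indicator hmeas, ← hmp.integral_comp' (g := (Ftrunc t).indicator g),
    Measure.volume_eq_prod, integral_prod _ hint',
    intervalIntegral.integral_of_le (by norm_num), ← integral_Icc_eq_integral_Ioc,
    ← integral_indicator measurableSet_Icc]
  refine integral_congr_ae (.of_forall fun u => ?_)
  by_cases hu : |u| ≤ 1 / 2
  · simp only [Set.indicator_of_mem (show u ∈ Set.Icc (-(1 / 2) : ℝ) (1 / 2) from abs_le.1 hu)]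
    rw [intervalIntegral.integral_of_le ((arcHeight_le_one u).trans ht),
      ← integral_Icc_eq_integral_Ioc, ← integral_indicator measurableSet_Icc]
    refine integral_congr_ae (.of_forall fun v => ?_)
    simp only [measurableEquivRealProd_symm_apply, Set.indicator, mem_Ftrunc_iff, hu, true_and]
    rw [mk_eq_add_mul_I]
  · simp only [Set.indicator_of_notMem
      (show u ∉ Set.Icc (-(1 / 2) : ℝ) (1 / 2) from fun h => hu (abs_le.2 h))]
    simp only [measurableEquivRealProd_symm_apply, Set.indicator, mem_Ftrunc_iff, hu, false_and,
      if_false, integral_zero]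

/-- The affine parametrization, by `s ∈ [0, 1]`, of the vertical segment from the height `φ u` to
the height `t` above `u`. -/
noncomputable def verticalSegment (φ : ℝ → ℝ) (t u s : ℝ) : ℂ :=
  u + ((φ u + (t - φ u) * s : ℝ) : ℂ) * I

lemma verticalSegment_im_pos {φ : ℝ → ℝ} {t u s : ℝ} (hφ : 0 < φ u) (hφt : φ u ≤ t)
    (hs : s ∈ Set.Icc (0 : ℝ) 1) : 0 < (verticalSegment φ t u s).im := by
  simp only [verticalSegment, add_im, ofReal_im, mul_im, ofReal_re, I_im, I_re, mul_zero, mul_one,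
    add_zero, zero_add]
  nlinarith [hs.1, mul_nonneg (sub_nonneg.2 hφt) hs.1]

lemma hasDerivAt_verticalSegment_left {φ : ℝ → ℝ} {φ' t u s : ℝ} (hφ : HasDerivAt φ φ' u) :
    HasDerivAt (fun x => verticalSegment φ t x s) (1 + ((φ' * (1 - s) : ℝ) : ℂ) * I) u := by
  have h := (hφ.add ((hφ.const_sub t).mul_const s)).ofReal_comp.mul_const I
  refine ((hasDerivAt_id u).ofReal_comp.add h).congr_deriv ?_
  push_cast
  ring

lemma hasDerivAt_verticalSegment_right (φ : ℝ → ℝ) (t u s : ℝ) :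
    HasDerivAt (fun x => verticalSegment φ t u x) (((t - φ u : ℝ) : ℂ) * I) s := by
  have h := (((hasDerivAt_id s).const_mul (t - φ u)).const_add (φ u)).ofReal_comp.mul_const I
  refine (h.const_add (u : ℂ)).congr_deriv ?_
  simp

/-- The `u`-derivative of `(t - φ u) h(z)` at the point `z = verticalSegment φ t u s`. -/
noncomputable def segmentDeriv (h : ℂ → ℂ) (φ φ' : ℝ → ℝ) (t u s : ℝ) : ℂ :=
  -(φ' u : ℂ) * h (verticalSegment φ t u s) +
    (t - φ u : ℝ) * fderiv ℝ h (verticalSegment φ t u s) (1 + ((φ' u * (1 - s) : ℝ) : ℂ) * I)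

section GraphRegion

variable {h : ℂ → ℂ} {φ φ' : ℝ → ℝ} {a b t : ℝ}

lemma differentiableAt_of_im_pos (hh : ContDiffOn ℝ 1 h {z : ℂ | 0 < z.im}) {z : ℂ}
    (hz : 0 < z.im) : DifferentiableAt ℝ h z :=
  (hh.differentiableOn one_ne_zero).differentiableAt
    ((isOpen_lt continuous_const continuous_im).mem_nhds hz)

lemma continuousOn_fderiv_of_im_pos (hh : ContDiffOn ℝ 1 h {z : ℂ | 0 < z.im}) :
    ContinuousOn (fderiv ℝ h) {z : ℂ | 0 < z.im} :=
  hh.continuousOn_fderiv_of_isOpen (isOpen_lt continuous_const continuous_im) le_rfl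

lemma continuousOn_segmentDeriv (hh : ContDiffOn ℝ 1 h {z : ℂ | 0 < z.im})
    (hφ : ∀ u ∈ Set.Icc a b, HasDerivAt φ (φ' u) u) (hφ' : ContinuousOn φ' (Set.Icc a b))
    (hpos : ∀ u ∈ Set.Icc a b, 0 < φ u) (hle : ∀ u ∈ Set.Icc a b, φ u ≤ t) :
    ContinuousOn (fun p : ℝ × ℝ => segmentDeriv h φ φ' t p.1 p.2)
      (Set.Icc a b ×ˢ Set.Icc (0 : ℝ) 1) := by
  have hmaps : Set.MapsTo (fun p : ℝ × ℝ => p.1) (Set.Icc a b ×ˢ Set.Icc (0 : ℝ) 1)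
      (Set.Icc a b) := fun p hp => hp.1
  have hφc : ContinuousOn φ (Set.Icc a b) := fun u hu => (hφ u hu).continuousAt.continuousWithinAt
  have c1 := hφc.comp continuousOn_fst hmaps
  have c2 := hφ'.comp continuousOn_fst hmaps
  simp only [Function.comp_def] at c1 c2
  have cP : ContinuousOn (fun p : ℝ × ℝ => verticalSegment φ t p.1 p.2)
      (Set.Icc a b ×ˢ Set.Icc (0 : ℝ) 1) := by
    unfold verticalSegment
    fun_prop
  have mP : Set.MapsTo (fun p : ℝ × ℝ => verticalSegment φ t p.1 p.2)
      (Set.Icc a b ×ˢ Set.Icc (0 : ℝ) 1) {z : ℂ | 0 < z.im} := fun p hp =>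
    verticalSegment_im_pos (hpos _ hp.1) (hle _ hp.1) hp.2
  have c3 := hh.continuousOn.comp cP mP
  have c4 := (continuousOn_fderiv_of_im_pos hh).comp cP mP
  simp only [Function.comp_def] at c3 c4
  exact ((continuous_ofReal.comp_continuousOn c2).neg.mul c3).add
    ((continuous_ofReal.comp_continuousOn (continuousOn_const.sub c1)).mul
      (c4.clm_apply (by fun_prop)))

lemma hasDerivAt_segment (hh : ContDiffOn ℝ 1 h {z : ℂ | 0 < z.im}) {u s : ℝ}
    (hφ : HasDerivAt φ (φ' u) u) (hpos : 0 < φ u) (hle : φ u ≤ t)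
    (hs : s ∈ Set.Icc (0 : ℝ) 1) :
    HasDerivAt (fun x => (t - φ x : ℝ) * h (verticalSegment φ t x s))
      (segmentDeriv h φ φ' t u s) u := by
  have hd := (differentiableAt_of_im_pos hh (verticalSegment_im_pos hpos hle hs)).hasFDerivAt
  have h1 := hd.comp_hasDerivAt u (hasDerivAt_verticalSegment_left (t := t) (s := s) hφ)
  refine ((hφ.const_sub t).ofReal_comp.mul h1).congr_deriv ?_
  simp only [segmentDeriv, Function.comp_def, ofReal_neg]

/-- Stokes' theorem for `h dz̄` on one vertical segment of the region above a graph. -/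
lemma integral_vertical (hh : ContDiffOn ℝ 1 h {z : ℂ | 0 < z.im}) {u : ℝ}
    (hpos : 0 < φ u) (hle : φ u ≤ t) :
    ∫ v in φ u..t, (fderiv ℝ h (u + v * I) I + I * fderiv ℝ h (u + v * I) 1) =
      h (u + t * I) - (1 - I * φ' u) * h (u + φ u * I) +
        I * ∫ s in (0 : ℝ)..1, segmentDeriv h φ φ' t u s := by
  have him : ∀ {s}, s ∈ Set.uIcc (0 : ℝ) 1 → 0 < (verticalSegment φ t u s).im := fun hs =>
    verticalSegment_im_pos hpos hle (by rwa [Set.uIcc_of_le zero_le_one] at hs)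
  have cP : ContinuousOn (fun s => verticalSegment φ t u s) (Set.uIcc 0 1) := fun s _ =>
    (hasDerivAt_verticalSegment_right φ t u s).continuousAt.continuousWithinAt
  have c3 := hh.continuousOn.comp cP (fun s hs => him hs)
  have c4 := (continuousOn_fderiv_of_im_pos hh).comp cP (fun s hs => him hs)
  have cS : ContinuousOn (fun s => segmentDeriv h φ φ' t u s) (Set.uIcc 0 1) :=
    (continuousOn_const.mul c3).add (continuousOn_const.mul (c4.clm_apply (by fun_prop)))
  have cD : ContinuousOn (fun s => (t - φ u : ℝ) • (fderiv ℝ h (verticalSegment φ t u s) I +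
      I * fderiv ℝ h (verticalSegment φ t u s) 1)) (Set.uIcc 0 1) :=
    ((c4.clm_apply (continuousOn_const (c := I))).add ((continuousOn_const (c := I)).mul
      (c4.clm_apply (continuousOn_const (c := (1 : ℂ)))))).const_smul (t - φ u)
  have hsub := intervalIntegral.smul_integral_comp_add_mul (a := 0) (b := 1)
    (fun v : ℝ => fderiv ℝ h (u + v * I) I + I * fderiv ℝ h (u + v * I) 1) (t - φ u) (φ u)
  rw [mul_zero, add_zero, mul_one, add_sub_cancel] at hsub
  have hftc : ∫ s in (0 : ℝ)..1, ((t - φ u : ℝ) • (fderiv ℝ h (verticalSegment φ t u s) I +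
      I * fderiv ℝ h (verticalSegment φ t u s) 1) - I * segmentDeriv h φ φ' t u s) =
      (1 - I * φ' u * (1 - (1 : ℝ))) * h (verticalSegment φ t u 1) -
        (1 - I * φ' u * (1 - (0 : ℝ))) * h (verticalSegment φ t u 0) := by
    refine intervalIntegral.integral_eq_sub_of_hasDerivAt
      (f := fun s : ℝ => (1 - I * φ' u * (1 - s)) * h (verticalSegment φ t u s))
      (fun s hs => ?_) (cD.sub (continuousOn_const.mul cS)).intervalIntegrable
    · have hd := (differentiableAt_of_im_pos hh (him hs)).hasFDerivAt
      have h1 := hd.comp_hasDerivAt s (hasDerivAt_verticalSegment_right φ t u s)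
      have h2 := (((hasDerivAt_id s).ofReal_comp.const_sub 1).const_mul (I * φ' u)).const_sub 1
      refine (h2.mul h1).congr_deriv ?_
      simp only [segmentDeriv, Function.comp_apply, ← real_smul (z := I), map_add, map_smul, id]
      simp only [real_smul]
      push_cast
      ring
  rw [intervalIntegral.integral_sub, intervalIntegral.integral_smul,
    intervalIntegral.integral_const_mul] at hftc
  · rw [← hsub]
    simp only [verticalSegment] at hftc ⊢
    rw [sub_eq_iff_eq_add] at hftc
    rw [hftc]
    simp
  · exact cD.intervalIntegrable
  · exact (continuousOn_const.mul cS).intervalIntegrable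

/-- Stokes' theorem for `h dz̄` on the region between the graph of `φ` and the height `t`, when the
contributions of the two vertical sides cancel. -/
lemma integral_above_graph (hab : a ≤ b) (hh : ContDiffOn ℝ 1 h {z : ℂ | 0 < z.im})
    (hφ : ∀ u ∈ Set.Icc a b, HasDerivAt φ (φ' u) u) (hφ' : ContinuousOn φ' (Set.Icc a b))
    (hpos : ∀ u ∈ Set.Icc a b, 0 < φ u) (hle : ∀ u ∈ Set.Icc a b, φ u ≤ t)
    (hφab : φ a = φ b) (hside : ∀ v : ℝ, 0 < v → h (a + v * I) = h (b + v * I)) :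
    ∫ u in a..b, ∫ v in φ u..t, (fderiv ℝ h (u + v * I) I + I * fderiv ℝ h (u + v * I) 1) =
      (∫ u in a..b, h (u + t * I)) - ∫ u in a..b, (1 - I * φ' u) * h (u + φ u * I) := by
  have hicc : Set.uIcc a b = Set.Icc a b := Set.uIcc_of_le hab
  have hφc : ContinuousOn φ (Set.Icc a b) := fun u hu => (hφ u hu).continuousAt.continuousWithinAt
  have hint : IntegrableOn (fun p : ℝ × ℝ => segmentDeriv h φ φ' t p.1 p.2)
      (Set.uIoc a b ×ˢ Set.uIoc (0 : ℝ) 1) := by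
    refine ((continuousOn_segmentDeriv hh hφ hφ' hpos hle).integrableOn_compact
      (isCompact_Icc.prod isCompact_Icc)).mono_set ?_
    rw [Set.uIoc_of_le hab, Set.uIoc_of_le zero_le_one]
    exact Set.prod_mono Set.Ioc_subset_Icc_self Set.Ioc_subset_Icc_self
  have hcancel : ∫ u in a..b, ∫ s in (0 : ℝ)..1, segmentDeriv h φ φ' t u s = 0 := by
    rw [intervalIntegral_intervalIntegral_swap (F := segmentDeriv h φ φ' t) hint]
    refine intervalIntegral.integral_zero_ae (.of_forall fun s hs => ?_)
    have hs' : s ∈ Set.Icc (0 : ℝ) 1 :=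
      Set.Ioc_subset_Icc_self (by rwa [Set.uIoc_of_le zero_le_one] at hs)
    rw [intervalIntegral.integral_eq_sub_of_hasDerivAt
      (f := fun u => (t - φ u : ℝ) * h (verticalSegment φ t u s))]
    · simp only [verticalSegment, hφab]
      rw [hside, sub_self]
      have hb : b ∈ Set.Icc a b := ⟨hab, le_rfl⟩
      nlinarith [hs'.1, hpos b hb, mul_nonneg (sub_nonneg.2 (hle b hb)) hs'.1]
    · intro u hu
      rw [hicc] at hu
      exact hasDerivAt_segment hh (hφ u hu) (hpos u hu) (hle u hu) hs'
    · refine ContinuousOn.intervalIntegrable ?_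
      rw [hicc]
      exact (continuousOn_segmentDeriv hh hφ hφ' hpos hle).comp
        (f := fun u => (u, s)) (by fun_prop) (fun u hu => ⟨hu, hs'⟩)
  have hinner : IntervalIntegrable (fun u => ∫ s in (0 : ℝ)..1, segmentDeriv h φ φ' t u s)
      volume a b := by
    rw [intervalIntegrable_iff]
    simp only [intervalIntegral.integral_of_le zero_le_one]
    rw [Set.uIoc_of_le (zero_le_one (α := ℝ)), IntegrableOn, Measure.volume_eq_prod,
      ← Measure.prod_restrict] at hint
    exact hint.integral_prod_left
  have htop : IntervalIntegrable (fun u : ℝ => h (u + t * I)) volume a b := by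
    refine ContinuousOn.intervalIntegrable (hh.continuousOn.comp (by fun_prop) fun u hu => ?_)
    rw [hicc] at hu
    simpa using (hpos u hu).trans_le (hle u hu)
  have hbot : IntervalIntegrable (fun u : ℝ => (1 - I * φ' u) * h (u + φ u * I))
      volume a b := by
    refine ContinuousOn.intervalIntegrable ?_
    rw [hicc]
    have c : ContinuousOn (fun u : ℝ => h (u + φ u * I)) (Set.Icc a b) :=
      hh.continuousOn.comp (by fun_prop) fun u hu => by simpa using hpos u hu
    exact (continuousOn_const.sub
      (continuousOn_const.mul (continuous_ofReal.comp_continuousOn hφ'))).mul c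
  rw [intervalIntegral.integral_congr (g := fun u : ℝ =>
      h (u + t * I) - (1 - I * φ' u) * h (u + φ u * I) +
        I * ∫ s in (0 : ℝ)..1, segmentDeriv h φ φ' t u s),
    intervalIntegral.integral_add (htop.sub hbot) (hinner.const_mul I),
    intervalIntegral.integral_sub htop hbot, intervalIntegral.integral_const_mul, hcancel,
    mul_zero, add_zero]
  intro u hu
  rw [hicc] at hu
  exact integral_vertical hh (hpos u hu) (hle u hu)

end GraphRegion

lemma intervalIntegral_eq_zero_of_odd {f : ℝ → ℂ} {c : ℝ}
    (hf : ∀ u ∈ Set.uIcc (-c) c, f (-u) = -f u) : ∫ u in (-c)..c, f u = 0 := by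
  have h := intervalIntegral.integral_comp_neg (a := -c) (b := c) f
  rw [neg_neg, intervalIntegral.integral_congr hf, intervalIntegral.integral_neg] at h
  exact self_eq_neg.1 h.symm

/-- The form `h dz̄` integrates to zero along the arc `|z| = 1`, `|Re z| ≤ 1/2`, if it is invariant
under `z ↦ -1/z`. -/
lemma integral_arc_eq_zero {h : ℂ → ℂ}
    (hS : ∀ z : ℂ, 0 < z.im → h (-1 / z) = (starRingEnd ℂ z) ^ 2 * h z) :
    ∫ u in (-(1 / 2) : ℝ)..(1 / 2),
      (1 - I * (-u / arcHeight u : ℝ)) * h (u + arcHeight u * I) = 0 := by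
  refine intervalIntegral_eq_zero_of_odd fun u hu => ?_
  have hu' : |u| ≤ 1 / 2 := by
    rw [Set.uIcc_of_le (by norm_num)] at hu
    exact abs_le.2 hu
  have hpos := arcHeight_pos hu'
  have hsq : (arcHeight u : ℂ) ^ 2 = 1 - (u : ℂ) ^ 2 := by exact_mod_cast arcHeight_sq hu'
  have hne : (arcHeight u : ℂ) ≠ 0 := by exact_mod_cast hpos.ne'
  have key := hS (u + arcHeight u * I) (by simpa using hpos)
  have hz0 : (u + arcHeight u * I : ℂ) ≠ 0 := fun h0 => by
    have := congrArg Complex.im h0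
    simp at this
    exact hpos.ne' this
  have hinv : -1 / (u + arcHeight u * I : ℂ) = ((-u : ℝ) : ℂ) + arcHeight u * I := by
    rw [div_eq_iff hz0]
    push_cast
    linear_combination hsq - (arcHeight u : ℂ) ^ 2 * I_sq
  rw [hinv] at key
  simp only [arcHeight_neg]
  rw [key]
  simp only [map_add, map_mul, conj_ofReal, conj_I, ofReal_div, ofReal_neg]
  generalize h (u + arcHeight u * I) = w
  field_simp
  linear_combination (2 * arcHeight u * u ^ 2 + arcHeight u ^ 3 - arcHeight u ^ 2 * I * u) * w * I_sq
    - (arcHeight u + I * u) * w * hsq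

/-- Let `t > 1` and let `h : ℍ → ℂ` be smooth with `h(γz) = (conj(cz+d))² h(z)` for all
`γ ∈ SL₂(ℤ)` (i.e. `h(z) dz̄` is `SL₂(ℤ)`-invariant).  Then
`∫_{F_t} (∂h/∂v + i ∂h/∂u) du dv = ∫_{-1/2}^{1/2} h(u+it) du`. -/
theorem stmt13 (t : ℝ) (ht : 1 < t) (h : ℂ → ℂ)
    (hsmooth : ContDiffOn ℝ (⊤ : ℕ∞) h {z : ℂ | 0 < z.im})
    (htrans : ∀ a b c d : ℤ, a * d - b * c = 1 → ∀ z : ℂ, 0 < z.im →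
      h (((a : ℂ) * z + (b : ℂ)) / ((c : ℂ) * z + (d : ℂ)))
        = (starRingEnd ℂ ((c : ℂ) * z + (d : ℂ))) ^ 2 * h z) :
    (∫ z in Ftrunc t, (fderiv ℝ h z Complex.I + Complex.I * fderiv ℝ h z 1))
      = ∫ u in (-(1 / 2) : ℝ)..(1 / 2), h ((u : ℂ) + (t : ℂ) * Complex.I) := by
  have hh : ContDiffOn ℝ 1 h {z : ℂ | 0 < z.im} := hsmooth.of_le (by exact_mod_cast le_top)
  have hT : ∀ v : ℝ, 0 < v →
      h ((-(1 / 2) : ℝ) + v * I) = h ((1 / 2 : ℝ) + v * I) := fun v hv => by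
    have := htrans 1 1 0 1 (by norm_num) ((-(1 / 2) : ℝ) + v * I) (by simpa using hv)
    simp only [Int.cast_one, Int.cast_zero, zero_mul, zero_add, map_one, one_pow, one_mul,
      div_one] at this
    rw [← this]
    congr 1
    push_cast
    ring
  have hS : ∀ z : ℂ, 0 < z.im → h (-1 / z) = (starRingEnd ℂ z) ^ 2 * h z := fun z hz => by
    simpa using htrans 0 (-1) 1 0 (by norm_num) z hz
  have hcont : ContinuousOn (fun z => fderiv ℝ h z I + I * fderiv ℝ h z 1) (Ftrunc t) := by
    have := (continuousOn_fderiv_of_im_pos hh).mono (Ftrunc_subset t)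
    fun_prop
  rw [setIntegral_Ftrunc ht.le hcont,
    integral_above_graph (φ := arcHeight) (φ' := fun u => -u / arcHeight u) (by norm_num) hh
      (fun u hu => hasDerivAt_arcHeight (abs_le.2 hu))
      (continuousOn_id.neg.div continuous_arcHeight.continuousOn
        fun u hu => (arcHeight_pos (abs_le.2 hu)).ne')
      (fun u hu => arcHeight_pos (abs_le.2 hu))
      (fun u _ => (arcHeight_le_one u).trans ht.le) (arcHeight_neg _) hT,
    integral_arc_eq_zero hS, sub_zero]
end
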